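/- Let G be a hyperbolic group with a fixed finite generating set such that the horofunction boundary ∂_h G has no isolated points. (Every hyperbolic group has finitely many types of infinite atoms, so the type graph Γ with root node r is defined.) Let φ : C_r → ∂_h G be a system of addresses, and for g ∈ G let g|_r denote the homeomorphism of C_r induced by g via φ; each g|_r is a rational homeomorphism, so G^φ = {g|_r : g ∈ G} is a subgroup of the rational group R_{Γ,C_r}. Then the nucleus 𝒩_{G^φ} of G^φ is finite. -/

import Mathlib

open scoped Classical

noncomputable section

/-- The word length of `g` with respect to a generating set `S` (using letters from
`S ∪ S⁻¹`). -/
def wordLength {G : Type} [Group G] (S : Set G) (g : G) : ℕ :=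
  sInf {n | ∃ l : List G, l.length = n ∧ (∀ x ∈ l, x ∈ S ∨ x⁻¹ ∈ S) ∧ l.prod = g}

/-- The word metric on `G` with respect to `S`. -/
def wordDist {G : Type} [Group G] (S : Set G) (x y : G) : ℕ :=
  wordLength S (x⁻¹ * y)

/-- `p 0, p 1, …, p n` is a geodesic segment for the word metric. -/
def IsGeodesicSeg {G : Type} [Group G] (S : Set G) (p : ℕ → G) (n : ℕ) : Prop :=
  ∀ i j : ℕ, i ≤ j → j ≤ n → wordDist S (p i) (p j) = j - i

/-- The Cayley graph of `G` with respect to `S` is `δ`-hyperbolic: every side of every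
geodesic triangle lies in the `δ`-neighborhood of the union of the other two sides. -/
def SlimTriangles {G : Type} [Group G] (S : Set G) (δ : ℝ) : Prop :=
  ∀ (p q r : ℕ → G) (np nq nr : ℕ),
    IsGeodesicSeg S p np → IsGeodesicSeg S q nq → IsGeodesicSeg S r nr →
    p np = q 0 → q nq = r 0 → r nr = p 0 →
    ∀ i ≤ np, ∃ j : ℕ,
      (j ≤ nq ∧ (wordDist S (p i) (q j) : ℝ) ≤ δ) ∨
      (j ≤ nr ∧ (wordDist S (p i) (r j) : ℝ) ≤ δ)

/-- A group is hyperbolic if it has a finite generating set whose Cayley graph is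
`δ`-hyperbolic for some `δ > 0`. -/
def IsHyperbolicGroup (G : Type) [Group G] : Prop :=
  ∃ S : Set G, S.Finite ∧ Subgroup.closure S = ⊤ ∧ ∃ δ : ℝ, 0 < δ ∧ SlimTriangles S δ

/-- The ball of radius `n` about the identity. -/
def ball {G : Type} [Group G] (S : Set G) (n : ℕ) : Set G :=
  {x | wordLength S x ≤ n}

/-- `x ∼ y` for the ball `B_n`: the function `d_x - d_y` is constant on `B_n`. -/
def SameAtom {G : Type} [Group G] (S : Set G) (n : ℕ) (x y : G) : Prop :=
  ∀ a ∈ ball S n, ∀ b ∈ ball S n,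
    (wordDist S x a : ℤ) - (wordDist S y a : ℤ) =
      (wordDist S x b : ℤ) - (wordDist S y b : ℤ)

/-- The atom for `B_n` containing `x`. -/
def atomOf {G : Type} [Group G] (S : Set G) (n : ℕ) (x : G) : Set G :=
  {y | SameAtom S n x y}

/-- `𝒜_n(G)`: the infinite atoms for `B_n`. -/
def InfAtoms {G : Type} [Group G] (S : Set G) (n : ℕ) : Set (Set G) :=
  {A | (∃ x, A = atomOf S n x) ∧ A.Infinite}

/-- `g` is a morphism from the atom `A₁ ∈ 𝒜_m(G)` to the atom `A₂ ∈ 𝒜_n(G)`. -/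
def IsMorphism {G : Type} [Group G] (S : Set G) (g : G) (m : ℕ) (A₁ : Set G)
    (n : ℕ) (A₂ : Set G) : Prop :=
  ((g * ·) '' A₁ = A₂) ∧
  (∀ k : ℕ, (g * ·) '' (A₁ ∩ ball S (m + k)) = A₂ ∩ ball S (n + k)) ∧
  ∀ k : ℕ, 0 < k → ∀ A' ∈ InfAtoms S (m + k), A' ⊆ A₁ →
    (g * ·) '' A' ∈ InfAtoms S (n + k) ∧ (g * ·) '' A' ⊆ A₂

/-- Two atoms have the same type if there is a morphism between them. -/
def SameType {G : Type} [Group G] (S : Set G) (m : ℕ) (A₁ : Set G) (n : ℕ)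
    (A₂ : Set G) : Prop :=
  ∃ g : G, IsMorphism S g m A₁ n A₂

/-- `N(A)`: the set of points of `B_n` at which `d̄_A` attains its minimum, i.e. the set
of nearest neighbors in `B_n` of the points of `A`. -/
def nearestSet {G : Type} [Group G] (S : Set G) (n : ℕ) (A : Set G) : Set G :=
  {p | p ∈ ball S n ∧ ∀ x ∈ A, ∀ q ∈ ball S n, wordDist S x p ≤ wordDist S x q}
/-- The additive subgroup of constant functions in `G → ℤ`. -/
def constFuns (K : Type) : AddSubgroup (K → ℤ) where
  carrier := {f | ∃ c : ℤ, ∀ y, f y = c}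
  zero_mem' := ⟨0, fun _ => rfl⟩
  add_mem' := by
    intro f g hf hg
    obtain ⟨c, hc⟩ := hf
    obtain ⟨d, hd⟩ := hg
    exact ⟨c + d, fun y => by simp [Pi.add_apply, hc y, hd y]⟩
  neg_mem' := by
    intro f hf
    obtain ⟨c, hc⟩ := hf
    exact ⟨-c, fun y => by simp [Pi.neg_apply, hc y]⟩

/-- `F̄(G,ℤ)`: integer valued functions on `K` modulo constants, with the quotient of
the product topology. -/
abbrev FBar (K : Type) := (K → ℤ) ⧸ constFuns K

/-- The image `d̄_x ∈ F̄(G,ℤ)` of the distance function `d_x = d(x,·)`. -/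
def dbar {K : Type} [Group K] (S : Set K) (x : K) : FBar K :=
  QuotientAddGroup.mk (fun y => (wordDist S x y : ℤ))

/-- The horofunction boundary: the set of limit points of `{d̄_x : x ∈ G}` in
`F̄(G,ℤ)`. -/
def horoBoundary {K : Type} [Group K] (S : Set K) : Set (FBar K) :=
  {φ | φ ∈ closure (Set.range (dbar S) \ {φ})}

/-- Precomposition with left translation by `g⁻¹`, as an additive homomorphism. -/
def translateHom {K : Type} [Group K] (g : K) : (K → ℤ) →+ (K → ℤ) where
  toFun f := fun y => f (g⁻¹ * y)
  map_zero' := rfl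
  map_add' _ _ := rfl

/-- The action of `g ∈ G` on `F̄(G,ℤ)` (inducing the action on the horofunction
boundary). -/
def boundaryAct {K : Type} [Group K] (g : K) : FBar K → FBar K :=
  ⇑(QuotientAddGroup.map (constFuns K) (constFuns K) (translateHom g)
    (by
      intro f hf
      obtain ⟨c, hc⟩ := hf
      exact ⟨c, fun y => hc _⟩))

/-- The shadow `∂A` of an atom `A` for `B_n`: the set of boundary points that agree
with `d̄_A` on `B_n`. -/
def shadowSet {K : Type} [Group K] (S : Set K) (n : ℕ) (A : Set K) : Set (FBar K) :=
  {ψ | ψ ∈ horoBoundary S ∧ ∃ h : K → ℤ, (QuotientAddGroup.mk h : FBar K) = ψ ∧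
    ∃ x ∈ A, ∀ a ∈ ball S n, ∀ b ∈ ball S n,
      h a - (wordDist S x a : ℤ) = h b - (wordDist S x b : ℤ)}
/-- A finite directed graph (loops and parallel edges are allowed). -/
structure FinDigraph : Type 1 where
  V : Type
  E : Type
  [fintypeV : Fintype V]
  [fintypeE : Fintype E]
  o : E → V
  t : E → V

attribute [instance] FinDigraph.fintypeV FinDigraph.fintypeE

instance (Γ : FinDigraph) : TopologicalSpace Γ.E := ⊥
instance (Γ : FinDigraph) : DiscreteTopology Γ.E := ⟨rfl⟩

namespace FinDigraph

variable (Γ : FinDigraph)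

/-- The subshift of finite type `Σ_Γ`: the set of all infinite directed paths in `Γ`,
viewed as a subset of the product space of all edge sequences (each edge's terminus is
the origin of the next edge). -/
def shift : Set (ℕ → Γ.E) := {x | ∀ i, Γ.t (x i) = Γ.o (x (i + 1))}

/-- Validity of a finite directed path starting at a given node. -/
def pathOk : Γ.V → List Γ.E → Prop
  | _, [] => True
  | v, e :: l => Γ.o e = v ∧ pathOk (Γ.t e) l

/-- A finite directed path in `Γ` (a node together with a compatible list of edges;
a path with no edges is a node, regarded as a path of length `0`). -/
structure FinPath where
  start : Γ.V
  edges : List Γ.E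
  ok : Γ.pathOk start edges

/-- Terminus of a list of edges starting at a given node. -/
def pathEndAux : Γ.V → List Γ.E → Γ.V
  | v, [] => v
  | _, e :: l => pathEndAux (Γ.t e) l

/-- The terminus `t(α)` of a finite directed path. -/
def pathEnd (α : Γ.FinPath) : Γ.V := Γ.pathEndAux α.start α.edges

/-- The length-0 path at a node `v`. -/
def trivPath (v : Γ.V) : Γ.FinPath := ⟨v, [], by simp [pathOk]⟩

/-- The cone `C_α ⊆ Σ_Γ` of all infinite directed paths having `α` as a prefix. -/
def cone (α : Γ.FinPath) : Set (ℕ → Γ.E) :=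
  {x | x ∈ Γ.shift ∧ Γ.o (x 0) = α.start ∧
    ∀ (i : ℕ) (h : i < α.edges.length), x i = α.edges.get ⟨i, h⟩}

/-- The canonical similarity `C_α → C_β` (for `t(α) = t(β)`) on the level of edge
sequences: delete the prefix `α` and attach the prefix `β`. -/
def splice (α β : Γ.FinPath) (x : ℕ → Γ.E) : ℕ → Γ.E := fun i =>
  if h : i < β.edges.length then β.edges.get ⟨i, h⟩
  else x (i - β.edges.length + α.edges.length)

/-- Concatenation `α · ω` of a finite path with an infinite path (on sequences). -/
def catPath (α : Γ.FinPath) (x : ℕ → Γ.E) : ℕ → Γ.E :=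
  Γ.splice (Γ.trivPath (Γ.pathEnd α)) α x

/-- The length of the path `f̄(α)`, i.e. of the greatest common prefix of all points
of `f(C_α)`. -/
def barLen (f : (ℕ → Γ.E) → ℕ → Γ.E) (α : Γ.FinPath) : ℕ :=
  sSup {n | ∀ x ∈ Γ.cone α, ∀ y ∈ Γ.cone α, ∀ i < n, f x i = f y i}

/-- The local action `f|_α : C_{t(α)} → C_{t(f̄(α))}`, determined by
`f(α·ω) = f̄(α)·(f|_α)(ω)`.  It is recorded together with the node `t(α)`
(the node of its domain cone), and is extended by the identity off the cone
`C_{t(α)}`. -/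
def localAction (f : (ℕ → Γ.E) → ℕ → Γ.E) (α : Γ.FinPath) :
    Γ.V × ((ℕ → Γ.E) → ℕ → Γ.E) :=
  (Γ.pathEnd α, fun w =>
    if w ∈ Γ.cone (Γ.trivPath (Γ.pathEnd α)) then
      fun i => f (Γ.catPath α w) (i + Γ.barLen f α)
    else w)

/-- A map is rational (on a domain `D`) if it has only finitely many distinct local
actions at cones contained in `D`. -/
def RationalOn (f : (ℕ → Γ.E) → ℕ → Γ.E) (D : Set (ℕ → Γ.E)) : Prop :=
  (Γ.localAction f '' {α : Γ.FinPath | Γ.cone α ⊆ D}).Finite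

/-- The nucleus `𝒩_f` of a map: the set of local actions `f|_α` that occur for
infinitely many finite paths `α` with `C_α` contained in the domain. -/
def nucleusOf (f : (ℕ → Γ.E) → ℕ → Γ.E) (D : Set (ℕ → Γ.E)) :
    Set (Γ.V × ((ℕ → Γ.E) → ℕ → Γ.E)) :=
  {p | {α : Γ.FinPath | Γ.cone α ⊆ D ∧ Γ.localAction f α = p}.Infinite}

/-- A nondegenerate map on `Σ_Γ` with domain `D`: it takes values in `Σ_Γ` and maps no
cone contained in `D` to a single point. -/
def Nondegenerate (f : (ℕ → Γ.E) → ℕ → Γ.E) (D : Set (ℕ → Γ.E)) : Prop :=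
  (∀ x ∈ D, f x ∈ Γ.shift) ∧
  ∀ α : Γ.FinPath, Γ.cone α ⊆ D → ¬∃ p, ∀ x ∈ Γ.cone α, f x = p

/-- Extension of a map `E → E'` between subsets of the sequence space to a globally
defined map (by the identity off `E`). -/
def homExt (E E' : Set (ℕ → Γ.E)) (f : ↥E → ↥E') : (ℕ → Γ.E) → ℕ → Γ.E :=
  fun x => if h : x ∈ E then ↑(f ⟨x, h⟩) else x

/-- Extension of a permutation of `E` to a globally defined map. -/
def permExt (E : Set (ℕ → Γ.E)) (g : Equiv.Perm ↥E) : (ℕ → Γ.E) → ℕ → Γ.E :=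
  Γ.homExt E E ⇑g

/-- `E` is a clopen subset of the subshift `Σ_Γ`. -/
def ClopenIn (E : Set (ℕ → Γ.E)) : Prop :=
  IsClopen {x : ↥Γ.shift | (x : ℕ → Γ.E) ∈ E}

/-- `U ⊆ Σ_Γ` is open in the subshift. -/
def OpenInShift (U : Set (ℕ → Γ.E)) : Prop :=
  IsOpen {x : ↥Γ.shift | (x : ℕ → Γ.E) ∈ U}

/-- The subshift `Σ_Γ` has no isolated points. -/
def NoIsolatedPoints : Prop := ∀ x : ↥Γ.shift, ¬IsOpen ({x} : Set ↥Γ.shift)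

/-- The subshift `Σ_Γ` has no empty cones. -/
def NoEmptyCones : Prop := ∀ α : Γ.FinPath, (Γ.cone α).Nonempty

/-- A permutation of `E` which is a homeomorphism and is a rational map:
an element of the rational group `R_{Γ,E}`. -/
def IsRatHomeo (E : Set (ℕ → Γ.E)) (g : Equiv.Perm ↥E) : Prop :=
  Continuous ⇑g ∧ Continuous ⇑g.symm ∧ Γ.RationalOn (Γ.permExt E g) E

/-- `g` maps the cone `C_α` to the cone `C_β` by the canonical similarity
`α·ω ↦ β·ω`. -/
def RealizesCanonSim (E : Set (ℕ → Γ.E)) (g : Equiv.Perm ↥E) (α β : Γ.FinPath) : Prop :=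
  ∀ x, ∀ hx : x ∈ E, x ∈ Γ.cone α → ↑(g ⟨x, hx⟩) = Γ.splice α β x

/-- A rational similarity group (RSG): a subgroup of the rational group `R_{Γ,E}` that
realizes the canonical similarity between any two cones `C_α, C_β ⊊ E` with
`t(α) = t(β)`. -/
def IsRSG (E : Set (ℕ → Γ.E)) (G : Subgroup (Equiv.Perm ↥E)) : Prop :=
  (∀ g ∈ G, Γ.IsRatHomeo E g) ∧
  ∀ α β : Γ.FinPath, Γ.pathEnd α = Γ.pathEnd β → Γ.cone α ⊂ E → Γ.cone β ⊂ E →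
    ∃ g ∈ G, Γ.RealizesCanonSim E g α β

/-- `h` locally agrees with the group `G`: every point has an open neighborhood on
which `h` coincides with some element of `G`. -/
def LocallyAgrees (E : Set (ℕ → Γ.E)) (G : Subgroup (Equiv.Perm ↥E))
    (h : Equiv.Perm ↥E) : Prop :=
  ∀ x : ↥E, ∃ U : Set ↥E, IsOpen U ∧ x ∈ U ∧ ∃ g ∈ G, ∀ u ∈ U, h u = g u

/-- `G` is full as a group of homeomorphisms of `E`: every homeomorphism of `E` that
locally agrees with `G` already belongs to `G`. -/
def IsFullOn (E : Set (ℕ → Γ.E)) (G : Subgroup (Equiv.Perm ↥E)) : Prop :=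
  ∀ h : Equiv.Perm ↥E, Continuous ⇑h → Continuous ⇑h.symm →
    Γ.LocallyAgrees E G h → h ∈ G

/-- The nucleus `𝒩_G` of a subgroup `G ≤ R_{Γ,E}`: the union of the nuclei of its
elements. -/
def groupNucleus (E : Set (ℕ → Γ.E)) (G : Subgroup (Equiv.Perm ↥E)) :
    Set (Γ.V × ((ℕ → Γ.E) → ℕ → Γ.E)) :=
  ⋃ g ∈ G, Γ.nucleusOf (Γ.permExt E g) E

/-- An edge of the induced subgraph on a set `W` of nodes. -/
def InducedEdge (W : Set Γ.V) (e : Γ.E) : Prop := Γ.o e ∈ W ∧ Γ.t e ∈ W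

/-- A path of the induced subgraph on `W`. -/
def PathIn (W : Set Γ.V) (α : Γ.FinPath) : Prop :=
  α.start ∈ W ∧ ∀ e ∈ α.edges, Γ.InducedEdge W e

/-- The induced subgraph on `W` is strongly connected and is not a directed cycle,
i.e. `Σ_{Γ₀}` is irreducible (where `Γ₀` is the induced subgraph on `W`). -/
def IrreducibleOn (W : Set Γ.V) : Prop :=
  (∀ v ∈ W, ∀ w ∈ W, ∃ α : Γ.FinPath,
      α.start = v ∧ Γ.pathEnd α = w ∧ α.edges ≠ [] ∧ Γ.PathIn W α) ∧
  ¬∀ v ∈ W, ∃! e : Γ.E, Γ.InducedEdge W e ∧ Γ.o e = v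

/-- `Σ_Γ` has an irreducible core: an induced subgraph `Γ₀` (on a node set `W`) with
`Σ_{Γ₀}` irreducible, such that every node has a directed path to `Γ₀` and every
sufficiently long directed path ends in `Γ₀`. -/
def HasIrreducibleCore : Prop :=
  ∃ W : Set Γ.V, Γ.IrreducibleOn W ∧
    (∀ v : Γ.V, ∃ α : Γ.FinPath, α.start = v ∧ Γ.pathEnd α ∈ W) ∧
    ∃ N : ℕ, ∀ α : Γ.FinPath, α.edges.length = N → Γ.pathEnd α ∈ W

/-- `G ≤ R_{Γ,E}` is contracting: `Σ_Γ` has an irreducible core and the nucleus `𝒩_G`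
is finite. -/
def IsContracting (E : Set (ℕ → Γ.E)) (G : Subgroup (Equiv.Perm ↥E)) : Prop :=
  Γ.HasIrreducibleCore ∧ (Γ.groupNucleus E G).Finite

/-- An element of the Thompson group `V_{Γ,E}`: there are partitions of `E` into cones
`C_{α_1},…,C_{α_k}` and `C_{β_1},…,C_{β_k}` with `t(α_i) = t(β_i)` such that `g` maps
each `C_{α_i}` to `C_{β_i}` by the canonical similarity. -/
def IsThompson (E : Set (ℕ → Γ.E)) (g : Equiv.Perm ↥E) : Prop :=
  ∃ (k : ℕ) (α β : Fin k → Γ.FinPath),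
    (∀ i, Γ.pathEnd (α i) = Γ.pathEnd (β i)) ∧
    E = (⋃ i, Γ.cone (α i)) ∧
    Pairwise (fun i j => Disjoint (Γ.cone (α i)) (Γ.cone (α j))) ∧
    E = (⋃ i, Γ.cone (β i)) ∧
    Pairwise (fun i j => Disjoint (Γ.cone (β i)) (Γ.cone (β j))) ∧
    ∀ i, Γ.RealizesCanonSim E g (α i) (β i)

/-- A rational (eventually repeating) point `σ·τ^∞` of `Σ_Γ`. -/
def IsRationalPt (x : ℕ → Γ.E) : Prop :=
  ∃ σ τ : Γ.FinPath, τ.edges ≠ [] ∧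
    (∀ (i : ℕ) (h : i < σ.edges.length), x i = σ.edges.get ⟨i, h⟩) ∧
    ∀ i : ℕ, σ.edges.length ≤ i →
      ∀ h : (i - σ.edges.length) % τ.edges.length < τ.edges.length,
        x i = τ.edges.get ⟨(i - σ.edges.length) % τ.edges.length, h⟩

/-- `β = f̄(α)`: the cone `C_β` is the smallest cone containing `f(C_α)`, with `β` the
greatest common prefix of the points of `f(C_α)`. -/
def IsBar (f : (ℕ → Γ.E) → ℕ → Γ.E) (α β : Γ.FinPath) : Prop :=
  f '' Γ.cone α ⊆ Γ.cone β ∧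
  ∀ γ : Γ.FinPath, f '' Γ.cone α ⊆ Γ.cone γ →
    Γ.cone β ⊆ Γ.cone γ ∧ γ.edges.length ≤ β.edges.length

end FinDigraph

/-- The (level-indexed) infinite atoms of a group with generating set `S`. -/
def AtomIdx {K : Type} [Group K] (S : Set K) : Type :=
  Σ n : ℕ, {A : Set K // A ∈ InfAtoms S n}

/-- Two indexed atoms have the same type. -/
def SameTypeIdx {K : Type} [Group K] (S : Set K) (p q : AtomIdx S) : Prop :=
  SameType S p.1 p.2.1 q.1 q.2.1

/-- `Δ` (together with the type assignment `τ`) is the type graph: nodes are the types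
of infinite atoms, with as many edges from `v` to `w` as each atom of type `v` has
children of type `w`. -/
def IsTypeGraph {K : Type} [Group K] (S : Set K) (Δ : FinDigraph)
    (τ : AtomIdx S → Δ.V) : Prop :=
  Function.Surjective τ ∧
  (∀ p q : AtomIdx S, τ p = τ q ↔ SameTypeIdx S p q) ∧
  ∀ (p : AtomIdx S) (w : Δ.V),
    {q : AtomIdx S | q.1 = p.1 + 1 ∧ q.2.1 ⊆ p.2.1 ∧ τ q = w}.ncard =
      {e : Δ.E | Δ.o e = τ p ∧ Δ.t e = w}.ncard

section WordMetric

variable {G : Type} [Group G] {S : Set G}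

theorem exists_list_length_eq_wordLength (hgen : Subgroup.closure S = ⊤) (g : G) :
    ∃ l : List G, l.length = wordLength S g ∧ (∀ x ∈ l, x ∈ S ∨ x⁻¹ ∈ S) ∧ l.prod = g := by
  have hg : g ∈ Subgroup.closure S := hgen ▸ Subgroup.mem_top g
  rw [← Subgroup.mem_toSubmonoid, Subgroup.closure_toSubmonoid] at hg
  obtain ⟨l, hl, hp⟩ := Submonoid.exists_list_of_mem_closure hg
  exact Nat.sInf_mem
    (s := {n | ∃ l : List G, l.length = n ∧ (∀ x ∈ l, x ∈ S ∨ x⁻¹ ∈ S) ∧ l.prod = g})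
    ⟨l.length, l, rfl, hl, hp⟩

theorem wordLength_prod_le (l : List G) (hl : ∀ x ∈ l, x ∈ S ∨ x⁻¹ ∈ S) :
    wordLength S l.prod ≤ l.length :=
  Nat.sInf_le ⟨l, rfl, hl, rfl⟩

theorem wordLength_one : wordLength S (1 : G) = 0 := by
  simpa using wordLength_prod_le (S := S) ([] : List G) (by simp)

theorem wordLength_eq_zero (hgen : Subgroup.closure S = ⊤) {g : G} (h : wordLength S g = 0) :
    g = 1 := by
  obtain ⟨l, hl, -, hp⟩ := exists_list_length_eq_wordLength hgen g
  rw [h, List.length_eq_zero_iff] at hl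
  simpa [hl] using hp.symm

theorem wordLength_mul_le (hgen : Subgroup.closure S = ⊤) (g h : G) :
    wordLength S (g * h) ≤ wordLength S g + wordLength S h := by
  obtain ⟨l, hl, hs, rfl⟩ := exists_list_length_eq_wordLength hgen g
  obtain ⟨l', hl', hs', rfl⟩ := exists_list_length_eq_wordLength hgen h
  rw [← hl, ← hl', ← List.prod_append, ← List.length_append]
  refine wordLength_prod_le _ fun x hx => ?_
  rcases List.mem_append.1 hx with hx | hx
  exacts [hs x hx, hs' x hx]

theorem wordLength_inv_le (hgen : Subgroup.closure S = ⊤) (g : G) :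
    wordLength S g⁻¹ ≤ wordLength S g := by
  obtain ⟨l, hl, hs, rfl⟩ := exists_list_length_eq_wordLength hgen g
  rw [← hl, List.prod_inv_reverse]
  refine (wordLength_prod_le _ fun x hx => ?_).trans (by simp)
  simp only [List.mem_reverse, List.mem_map] at hx
  obtain ⟨y, hy, rfl⟩ := hx
  simpa [or_comm] using hs y hy

theorem wordLength_inv (hgen : Subgroup.closure S = ⊤) (g : G) :
    wordLength S g⁻¹ = wordLength S g :=
  (wordLength_inv_le hgen g).antisymm (by simpa using wordLength_inv_le hgen g⁻¹)

theorem wordDist_comm (hgen : Subgroup.closure S = ⊤) (x y : G) :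
    wordDist S x y = wordDist S y x := by
  rw [wordDist, wordDist, ← wordLength_inv hgen]
  simp

theorem wordDist_triangle (hgen : Subgroup.closure S = ⊤) (x y z : G) :
    wordDist S x z ≤ wordDist S x y + wordDist S y z := by
  simpa [wordDist, mul_assoc] using wordLength_mul_le hgen (x⁻¹ * y) (y⁻¹ * z)

theorem wordDist_self (x : G) : wordDist S x x = 0 := by
  simp [wordDist, wordLength_one]

theorem eq_of_wordDist_eq_zero (hgen : Subgroup.closure S = ⊤) {x y : G}
    (h : wordDist S x y = 0) : x = y :=
  (inv_mul_eq_one.1 (wordLength_eq_zero hgen h))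

theorem wordDist_one_left (x : G) : wordDist S 1 x = wordLength S x := by
  simp [wordDist]

theorem wordDist_mul_left (g x y : G) : wordDist S (g * x) (g * y) = wordDist S x y := by
  simp [wordDist, mul_assoc]

theorem wordDist_mul_right_eq (g x : G) : wordDist S g (g * x) = wordLength S x := by
  simp [wordDist]

theorem wordDist_mul_left_eq (g x y : G) : wordDist S (g * x) y = wordDist S x (g⁻¹ * y) := by
  simp [wordDist, mul_assoc]

theorem isGeodesicSeg_of_step (hgen : Subgroup.closure S = ⊤) {p : ℕ → G} {n : ℕ}
    (hstep : ∀ i < n, wordDist S (p i) (p (i + 1)) ≤ 1) (hn : n ≤ wordDist S (p 0) (p n)) :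
    IsGeodesicSeg S p n := by
  have key : ∀ i k, i + k ≤ n → wordDist S (p i) (p (i + k)) ≤ k := by
    intro i k
    induction k with
    | zero => intro _; simp [wordDist_self]
    | succ k ih =>
      intro h
      have h1 := ih (by omega)
      have h2 := hstep (i + k) (by omega)
      have h3 := wordDist_triangle hgen (p i) (p (i + k)) (p (i + k + 1))
      rw [← add_assoc]
      omega
  intro i j hij hj
  have h1 := key 0 i (by omega)
  have h2 := key i (j - i) (by omega)
  have h3 := key j (n - j) (by omega)
  rw [zero_add] at h1
  rw [show i + (j - i) = j by omega] at h2
  rw [show j + (n - j) = n by omega] at h3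
  have h4 := wordDist_triangle hgen (p 0) (p i) (p n)
  have h5 := wordDist_triangle hgen (p i) (p j) (p n)
  omega

theorem exists_isGeodesicSeg (hgen : Subgroup.closure S = ⊤) (x y : G) :
    ∃ p : ℕ → G, IsGeodesicSeg S p (wordDist S x y) ∧ p 0 = x ∧ p (wordDist S x y) = y := by
  obtain ⟨l, hl, hs, hp⟩ := exists_list_length_eq_wordLength hgen (x⁻¹ * y)
  have hend : x * (l.take (wordDist S x y)).prod = y := by
    rw [List.take_of_length_le (by rw [hl]; exact le_rfl), hp]
    simp
  refine ⟨fun i => x * (l.take i).prod, ?_, by simp, hend⟩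
  refine isGeodesicSeg_of_step hgen (fun i hi => ?_) ?_
  · have hi' : i < l.length := hl ▸ hi
    rw [wordDist_mul_left, List.prod_take_succ l i hi', wordDist_mul_right_eq]
    simpa using wordLength_prod_le (S := S) [l[i]] (by simpa using hs _ (List.getElem_mem hi'))
  · simp only [hend]
    simp

/-- The point `c` lies on a geodesic from `x` to `y`. -/
def GeodBetween (S : Set G) (x c y : G) : Prop :=
  wordDist S x c + wordDist S c y = wordDist S x y

theorem exists_geodBetween (hgen : Subgroup.closure S = ⊤) (x y : G) {i : ℕ}
    (hi : i ≤ wordDist S x y) : ∃ c, GeodBetween S x c y ∧ wordDist S x c = i := by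
  obtain ⟨p, hp, h0, h1⟩ := exists_isGeodesicSeg hgen x y
  have h2 := hp 0 i (by omega) hi
  have h3 := hp i _ hi le_rfl
  rw [h0] at h2
  rw [h1] at h3
  refine ⟨p i, ?_, by omega⟩
  unfold GeodBetween
  omega

theorem GeodBetween.exists_isGeodesicSeg (hgen : Subgroup.closure S = ⊤) {x c y : G}
    (h : GeodBetween S x c y) :
    ∃ p : ℕ → G, IsGeodesicSeg S p (wordDist S x y) ∧ p 0 = x ∧ p (wordDist S x y) = y ∧
      p (wordDist S x c) = c := by
  obtain ⟨p, hp, hp0, hp1⟩ := _root_.exists_isGeodesicSeg hgen x c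
  obtain ⟨q, hq, hq0, hq1⟩ := _root_.exists_isGeodesicSeg hgen c y
  unfold GeodBetween at h
  set u : ℕ → G := fun i => if i ≤ wordDist S x c then p i else q (i - wordDist S x c) with hu
  have hu1 : ∀ i ≤ wordDist S x c, u i = p i := fun i hi => by simp [hu, hi]
  have hu2 : ∀ i, wordDist S x c ≤ i → u i = q (i - wordDist S x c) := by
    intro i hi
    rcases hi.eq_or_lt with rfl | hi
    · simp [hu, hp1, hq0]
    · simp [hu, not_le.2 hi]
  have e0 : u 0 = x := by rw [hu1 0 (by omega), hp0]
  have e1 : u (wordDist S x y) = y := by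
    rw [hu2 _ (by omega), show wordDist S x y - wordDist S x c = wordDist S c y by omega, hq1]
  refine ⟨u, isGeodesicSeg_of_step hgen (fun i hi => ?_) (by rw [e0, e1]), e0, e1, ?_⟩
  · by_cases hc : i < wordDist S x c
    · rw [hu1 i hc.le, hu1 _ hc, hp i (i + 1) (by omega) hc]
      omega
    · rw [hu2 i (by omega), hu2 (i + 1) (by omega), hq _ _ (by omega) (by omega)]
      omega
  · rw [hu1 _ le_rfl, hp1]

/-- Slimness of geodesic triangles in terms of points lying between the vertices. -/
def SlimBetween (S : Set G) (Δ : ℕ) : Prop :=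
  ∀ x y z c : G, GeodBetween S x c y →
    ∃ q, wordDist S c q ≤ Δ ∧ (GeodBetween S y q z ∨ GeodBetween S x q z)

theorem SlimTriangles.slimBetween (hgen : Subgroup.closure S = ⊤) {δ : ℝ}
    (h : SlimTriangles S δ) : SlimBetween S ⌊δ⌋₊ := by
  intro x y z c hc
  obtain ⟨p, hp, hp0, hp1, hpc⟩ := hc.exists_isGeodesicSeg hgen
  obtain ⟨q, hq, hq0, hq1⟩ := exists_isGeodesicSeg hgen y z
  obtain ⟨r, hr, hr0, hr1⟩ := exists_isGeodesicSeg hgen z x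
  have hcle : wordDist S x c ≤ wordDist S x y := by
    unfold GeodBetween at hc
    omega
  obtain ⟨j, ⟨hj, hd⟩ | ⟨hj, hd⟩⟩ := h p q r _ _ _ hp hq hr (by rw [hp1, hq0])
    (by rw [hq1, hr0]) (by rw [hr1, hp0]) _ hcle
  · rw [hpc] at hd
    refine ⟨q j, Nat.le_floor hd, Or.inl ?_⟩
    have h1 := hq 0 j (by omega) hj
    have h2 := hq j _ hj le_rfl
    rw [hq0] at h1
    rw [hq1] at h2
    unfold GeodBetween
    omega
  · rw [hpc] at hd
    refine ⟨r j, Nat.le_floor hd, Or.inr ?_⟩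
    have h1 := hr 0 j (by omega) hj
    have h2 := hr j _ hj le_rfl
    rw [hr0] at h1
    rw [hr1] at h2
    unfold GeodBetween
    rw [wordDist_comm hgen x, wordDist_comm hgen _ z, wordDist_comm hgen x]
    omega

theorem finite_ball (hSfin : S.Finite) (hgen : Subgroup.closure S = ⊤) (n : ℕ) :
    (ball S n).Finite := by
  induction n with
  | zero =>
    refine (Set.finite_singleton (1 : G)).subset fun x hx => ?_
    exact wordLength_eq_zero hgen (Nat.le_zero.1 hx)
  | succ n ih =>
    refine ((Set.Finite.mul (hSfin.union hSfin.inv) ih).union (Set.finite_singleton 1)).subset ?_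
    intro x hx
    obtain ⟨l, hl, hs, rfl⟩ := exists_list_length_eq_wordLength hgen x
    cases l with
    | nil => right; simp
    | cons e l =>
      left
      rw [List.prod_cons]
      refine Set.mul_mem_mul (hs e (by simp)) ?_
      have h1 := wordLength_prod_le (S := S) l fun y hy => hs y (by simp [hy])
      have h2 : wordLength S (e :: l).prod ≤ n + 1 := hx
      rw [List.length_cons] at hl
      show wordLength S l.prod ≤ n
      omega

end WordMetric

section Atoms

variable {G : Type} [Group G] {S : Set G}

/-- `d_x - d_y` is constant on `U`. -/
def SameOn (S U : Set G) (x y : G) : Prop :=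
  ∀ a ∈ U, ∀ b ∈ U,
    (wordDist S x a : ℤ) - (wordDist S y a : ℤ) = (wordDist S x b : ℤ) - (wordDist S y b : ℤ)

theorem mem_ball_iff {n : ℕ} {x : G} : x ∈ ball S n ↔ wordDist S 1 x ≤ n := by
  rw [wordDist_one_left]
  rfl

theorem GeodBetween.trans (hgen : Subgroup.closure S = ⊤) {x c d y : G}
    (h : GeodBetween S x d y) (h' : GeodBetween S x c d) : GeodBetween S x c y := by
  unfold GeodBetween at *
  have h1 := wordDist_triangle hgen c d y
  have h2 := wordDist_triangle hgen x c y
  omega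

theorem geodBetween_right (x y : G) : GeodBetween S x y y := by
  simp [GeodBetween, wordDist_self]

theorem SameOn.of_geodBetween (hgen : Subgroup.closure S = ⊤) {U T : Set G} {x y : G}
    (h : SameOn S U x y) (hx : ∀ p ∈ T, ∃ q ∈ U, GeodBetween S x q p)
    (hy : ∀ p ∈ T, ∃ q ∈ U, GeodBetween S y q p) : SameOn S T x y := by
  intro a ha b hb
  obtain ⟨q₁, hq₁, h₁⟩ := hx a ha
  obtain ⟨q₂, hq₂, h₂⟩ := hy a ha
  obtain ⟨q₃, hq₃, h₃⟩ := hx b hb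
  obtain ⟨q₄, hq₄, h₄⟩ := hy b hb
  have e₂ := h q₁ hq₁ q₂ hq₂
  have e₃ := h q₁ hq₁ q₃ hq₃
  have e₄ := h q₁ hq₁ q₄ hq₄
  have t₁ := wordDist_triangle hgen y q₁ a
  have t₂ := wordDist_triangle hgen x q₂ a
  have t₃ := wordDist_triangle hgen y q₃ b
  have t₄ := wordDist_triangle hgen x q₄ b
  unfold GeodBetween at *
  omega

/-- Geodesics from the identity to points of an atom for `B_n` fellow travel, at distance `n`
from the identity, with any given point of the atom close to `B_n`. -/
theorem exists_geodBetween_near_of_sameAtom (hgen : Subgroup.closure S = ⊤) {n k : ℕ} {a x : G}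
    (h : SameAtom S n a x) (hx : n ≤ wordDist S 1 x) (ha : wordDist S 1 a ≤ n + k) :
    ∃ P, GeodBetween S 1 P x ∧ wordDist S 1 P = n ∧ wordDist S a P ≤ k := by
  obtain ⟨P, hP, hPn⟩ := exists_geodBetween hgen 1 x hx
  obtain ⟨z, hz, haz⟩ : ∃ z, wordDist S 1 z ≤ n ∧ wordDist S a z ≤ k := by
    by_cases han : wordDist S 1 a ≤ n
    · exact ⟨a, han, by simp [wordDist_self]⟩
    · obtain ⟨z, hz, hzn⟩ := exists_geodBetween hgen 1 a (i := n) (by omega)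
      refine ⟨z, hzn.le, ?_⟩
      rw [wordDist_comm hgen]
      unfold GeodBetween at hz
      omega
  refine ⟨P, hP, hPn, ?_⟩
  have h1 := h P (mem_ball_iff.2 hPn.le) z (mem_ball_iff.2 hz)
  have h2 := wordDist_triangle hgen 1 z x
  rw [wordDist_comm hgen z x] at h2
  unfold GeodBetween at hP
  rw [wordDist_comm hgen P x] at hP
  omega

theorem le_wordDist_one_of_sameAtom (hgen : Subgroup.closure S = ⊤) {n : ℕ} {x y : G}
    (h : SameAtom S n x y) (hxy : x ≠ y) : n ≤ wordDist S 1 x := by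
  by_contra! hn
  have hpos : 1 ≤ wordDist S x y :=
    Nat.one_le_iff_ne_zero.2 fun h0 => hxy (eq_of_wordDist_eq_zero hgen h0)
  obtain ⟨z, hz, hz1⟩ := exists_geodBetween hgen x y hpos
  have t := wordDist_triangle hgen 1 x z
  have h1 := h x (mem_ball_iff.2 hn.le) z (mem_ball_iff.2 (by omega))
  rw [wordDist_self, wordDist_comm hgen y x, wordDist_comm hgen y z] at h1
  unfold GeodBetween at hz
  omega

variable {Δ : ℕ}

theorem SlimBetween.exists_geodBetween_mem_ball (hgen : Subgroup.closure S = ⊤)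
    (hslim : SlimBetween S Δ) {o x P a p : G} {n k m : ℕ}
    (hP : GeodBetween S 1 P x) (hPn : wordDist S 1 P = n) (haP : wordDist S a P ≤ k)
    (ho : wordDist S 1 o + 3 * Δ < n) (hm : m + k + 4 * Δ ≤ wordDist S o a)
    (hp : wordDist S o p ≤ m) : ∃ q, wordDist S 1 q ≤ n ∧ GeodBetween S x q p := by
  obtain ⟨R, hR, hRn⟩ := exists_geodBetween hgen 1 P (i := n - 2 * Δ) (by omega)
  obtain ⟨c, hRc, hc⟩ := hslim 1 x o R (hP.trans hgen hR)
  have t1 := wordDist_triangle hgen 1 c R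
  rw [wordDist_comm hgen c R] at t1
  rcases hc with hc | hc
  · obtain ⟨q, hcq, hq⟩ := hslim x o p c hc
    rcases hq with hq | hq
    · refine ⟨p, ?_, geodBetween_right x p⟩
      have t2 := wordDist_triangle hgen 1 R c
      have t3 := wordDist_triangle hgen 1 c q
      have t4 := wordDist_triangle hgen 1 q p
      have t5 := wordDist_triangle hgen o q c
      have t6 := wordDist_triangle hgen o c R
      have t7 := wordDist_triangle hgen o R P
      have t8 := wordDist_triangle hgen o P a
      rw [wordDist_comm hgen q c] at t5
      rw [wordDist_comm hgen c R] at t6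
      rw [wordDist_comm hgen P a] at t8
      unfold GeodBetween at *
      omega
    · refine ⟨q, ?_, hq⟩
      have t2 := wordDist_triangle hgen 1 R c
      have t3 := wordDist_triangle hgen 1 c q
      omega
  · unfold GeodBetween at *
    omega

theorem SlimBetween.exists_geodBetween_mem_translate (hgen : Subgroup.closure S = ⊤)
    (hslim : SlimBetween S Δ) {o x P a p : G} {n k K m : ℕ}
    (hP : GeodBetween S 1 P x) (hPn : wordDist S 1 P = n) (haP : wordDist S a P ≤ k)
    (hm : wordDist S o a + K + 2 * Δ + k ≤ m) (hp : wordDist S 1 p ≤ n + K) :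
    ∃ q, wordDist S o q ≤ m ∧ GeodBetween S x q p := by
  obtain ⟨q, hPq, hq⟩ := hslim 1 x p P hP
  have t1 := wordDist_triangle hgen o a P
  have t2 := wordDist_triangle hgen o P q
  rcases hq with hq | hq
  · exact ⟨q, by omega, hq⟩
  · refine ⟨p, ?_, geodBetween_right x p⟩
    have t3 := wordDist_triangle hgen o q p
    have t4 := wordDist_triangle hgen 1 q P
    rw [wordDist_comm hgen q P] at t4
    unfold GeodBetween at *
    omega

theorem SlimBetween.wordDist_le (hgen : Subgroup.closure S = ⊤)
    (hslim : SlimBetween S Δ) {o x P Q a b : G} {n k C m : ℕ}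
    (hP : GeodBetween S 1 P x) (hPn : wordDist S 1 P = n) (haP : wordDist S a P ≤ k)
    (hQ : GeodBetween S o Q x) (hQm : wordDist S o Q = m) (hbQ : wordDist S b Q ≤ k)
    (ho : wordDist S 1 o + Δ < n) (hm : m ≤ wordDist S o a + C)
    (hm' : wordDist S o a ≤ m + C) : wordDist S b a ≤ C + 3 * k + 4 * Δ := by
  obtain ⟨c, hPc, hc⟩ := hslim 1 x o P hP
  have t1 := wordDist_triangle hgen 1 c P
  rw [wordDist_comm hgen c P] at t1
  rcases hc with hc | hc
  · obtain ⟨q, hcq, hq⟩ := hslim x o Q c hc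
    have u1 := wordDist_triangle hgen o a P
    have u2 := wordDist_triangle hgen o P c
    have u3 := wordDist_triangle hgen o c P
    have u4 := wordDist_triangle hgen o P a
    have u5 := wordDist_triangle hgen o c q
    have u6 := wordDist_triangle hgen o q c
    have u7 := wordDist_triangle hgen b Q q
    have u8 := wordDist_triangle hgen b q c
    have u9 := wordDist_triangle hgen b c P
    have u10 := wordDist_triangle hgen b P a
    have u11 := wordDist_triangle hgen o q x
    rw [wordDist_comm hgen q c] at u6 u8
    rw [wordDist_comm hgen c P] at u3 u9
    rw [wordDist_comm hgen P a] at u4 u10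
    rw [wordDist_comm hgen Q q] at u7
    unfold GeodBetween at *
    rw [wordDist_comm hgen x q, wordDist_comm hgen x Q] at hq
    omega
  · unfold GeodBetween at *
    omega

end Atoms

section FBar

variable {G : Type}

/-- The difference `ψ(a) - ψ(b)`, well defined for functions modulo constants. -/
def horoDiff (a b : G) : FBar G →+ ℤ :=
  QuotientAddGroup.lift (constFuns G)
    (Pi.evalAddMonoidHom (fun _ : G => ℤ) a - Pi.evalAddMonoidHom (fun _ : G => ℤ) b) (by
      rintro f ⟨c, hc⟩
      simp [hc])

theorem horoDiff_mk (a b : G) (h : G → ℤ) :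
    horoDiff a b (QuotientAddGroup.mk h : FBar G) = h a - h b :=
  rfl

theorem FBar.ext_horoDiff {ψ χ : FBar G} (h : ∀ a b, horoDiff a b ψ = horoDiff a b χ) :
    ψ = χ := by
  induction ψ using QuotientAddGroup.induction_on with | H f =>
  induction χ using QuotientAddGroup.induction_on with | H f' =>
  refine (QuotientAddGroup.eq).2 ?_
  rcases isEmpty_or_nonempty G with hG | ⟨⟨y₀⟩⟩
  · exact ⟨0, fun y => hG.elim y⟩
  refine ⟨f' y₀ - f y₀, fun y => ?_⟩
  have := h y y₀
  rw [horoDiff_mk, horoDiff_mk] at this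
  simp only [Pi.add_apply, Pi.neg_apply]
  omega

theorem continuous_horoDiff (a b : G) : Continuous (horoDiff a b) := by
  refine (QuotientAddGroup.isQuotientMap_mk (constFuns G)).continuous_iff.2 ?_
  exact (continuous_apply a).sub (continuous_apply b)

end FBar

section Boundary

variable {G : Type} [Group G] {S : Set G}

theorem horoDiff_dbar (a b x : G) :
    horoDiff a b (dbar S x) = (wordDist S x a : ℤ) - wordDist S x b :=
  rfl

theorem horoDiff_boundaryAct (a b g : G) (ψ : FBar G) :
    horoDiff a b (boundaryAct g ψ) = horoDiff (g⁻¹ * a) (g⁻¹ * b) ψ := by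
  induction ψ using QuotientAddGroup.induction_on
  rfl

theorem boundaryAct_mul (g h : G) (ψ : FBar G) :
    boundaryAct (g * h) ψ = boundaryAct g (boundaryAct h ψ) :=
  FBar.ext_horoDiff fun a b => by simp [horoDiff_boundaryAct, mul_assoc]

theorem boundaryAct_inv_apply (g : G) (ψ : FBar G) :
    boundaryAct g⁻¹ (boundaryAct g ψ) = ψ :=
  FBar.ext_horoDiff fun a b => by simp [horoDiff_boundaryAct]

theorem mem_shadowSet_iff {n : ℕ} {A : Set G} {ψ : FBar G} :
    ψ ∈ shadowSet S n A ↔ ψ ∈ horoBoundary S ∧ ∃ x ∈ A, ∀ a ∈ ball S n, ∀ b ∈ ball S n,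
      horoDiff a b ψ = (wordDist S x a : ℤ) - wordDist S x b := by
  refine and_congr_right fun _ => ⟨?_, ?_⟩
  · rintro ⟨h, rfl, x, hx, hh⟩
    refine ⟨x, hx, fun a ha b hb => ?_⟩
    have := hh a ha b hb
    rw [horoDiff_mk]
    omega
  · rintro ⟨x, hx, hh⟩
    induction ψ using QuotientAddGroup.induction_on with | H h =>
    refine ⟨h, rfl, x, hx, fun a ha b hb => ?_⟩
    have := hh a ha b hb
    rw [horoDiff_mk] at this
    omega

theorem exists_dbar_ne_of_mem_horoBoundary (hSfin : S.Finite) (hgen : Subgroup.closure S = ⊤)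
    {ψ : FBar G} (hψ : ψ ∈ horoBoundary S) (N : ℕ) :
    ∃ x, dbar S x ≠ ψ ∧ ∀ a ∈ ball S N, ∀ b ∈ ball S N,
      horoDiff a b ψ = (wordDist S x a : ℤ) - wordDist S x b := by
  have hfin := finite_ball hSfin hgen N
  have hopen : IsOpen (⋂ a ∈ ball S N, ⋂ b ∈ ball S N,
      {χ : FBar G | horoDiff a b χ = horoDiff a b ψ}) :=
    hfin.isOpen_biInter fun a _ => hfin.isOpen_biInter fun b _ =>
      (isOpen_discrete {horoDiff a b ψ}).preimage (continuous_horoDiff a b)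
  obtain ⟨_, hχ, ⟨x, rfl⟩, hne⟩ := mem_closure_iff.1 hψ _ hopen (by simp)
  refine ⟨x, hne, fun a ha b hb => ?_⟩
  simp only [Set.mem_iInter, Set.mem_ofPred_eq] at hχ
  rw [← hχ a ha b hb, horoDiff_dbar]

/-- Boundary points are approximated on balls by distance functions of far away points. -/
theorem exists_approx_of_mem_horoBoundary (hSfin : S.Finite) (hgen : Subgroup.closure S = ⊤)
    {ψ : FBar G} (hψ : ψ ∈ horoBoundary S) (N : ℕ) :
    ∃ x, N ≤ wordDist S 1 x ∧ ∀ a ∈ ball S N, ∀ b ∈ ball S N,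
      horoDiff a b ψ = (wordDist S x a : ℤ) - wordDist S x b := by
  obtain ⟨x, hx, hxN⟩ := exists_dbar_ne_of_mem_horoBoundary hSfin hgen hψ N
  obtain ⟨a, b, hab⟩ : ∃ a b, horoDiff a b (dbar S x) ≠ horoDiff a b ψ := by
    by_contra! h
    exact hx (FBar.ext_horoDiff h)
  obtain ⟨y, -, hy⟩ := exists_dbar_ne_of_mem_horoBoundary hSfin hgen hψ
    (N + wordDist S 1 a + wordDist S 1 b)
  refine ⟨x, le_wordDist_one_of_sameAtom hgen (y := y) ?_ ?_, hxN⟩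
  · intro a ha b hb
    have h1 := hxN a ha b hb
    rw [mem_ball_iff] at ha hb
    have h2 := hy a (mem_ball_iff.2 (by omega)) b (mem_ball_iff.2 (by omega))
    omega
  · rintro rfl
    refine hab ?_
    rw [hy a (mem_ball_iff.2 (by omega)) b (mem_ball_iff.2 (by omega)), horoDiff_dbar]

end Boundary

section Shadows

variable {G : Type} [Group G] {S : Set G}

/-- Two functions modulo constants have the same restriction to `U` modulo constants. -/
def AgreeOn (U : Set G) (ψ χ : FBar G) : Prop :=
  ∀ a ∈ U, ∀ b ∈ U, horoDiff a b ψ = horoDiff a b χ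

theorem sameAtom_of_mem_infAtoms {n : ℕ} {A : Set G} (hA : A ∈ InfAtoms S n) {x y : G}
    (hx : x ∈ A) (hy : y ∈ A) : SameAtom S n x y := by
  obtain ⟨⟨z, rfl⟩, -⟩ := hA
  intro a ha b hb
  have h1 := hx a ha b hb
  have h2 := hy a ha b hb
  omega

theorem agreeOn_ball_of_mem_shadowSet {n : ℕ} {A : Set G} (hA : A ∈ InfAtoms S n) {ψ χ : FBar G}
    (hψ : ψ ∈ shadowSet S n A) (hχ : χ ∈ shadowSet S n A) : AgreeOn (ball S n) ψ χ := by
  obtain ⟨-, x, hx, hψx⟩ := mem_shadowSet_iff.1 hψ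
  obtain ⟨-, y, hy, hχy⟩ := mem_shadowSet_iff.1 hχ
  intro a ha b hb
  have h1 := sameAtom_of_mem_infAtoms hA hx hy a ha b hb
  rw [hψx a ha b hb, hχy a ha b hb]
  omega

theorem AgreeOn.mem_shadowSet {n : ℕ} {A : Set G} {ψ χ : FBar G}
    (h : AgreeOn (ball S n) ψ χ) (hψ : ψ ∈ shadowSet S n A) (hχ : χ ∈ horoBoundary S) :
    χ ∈ shadowSet S n A := by
  obtain ⟨-, x, hx, hψx⟩ := mem_shadowSet_iff.1 hψ
  refine mem_shadowSet_iff.2 ⟨hχ, x, hx, fun a ha b hb => ?_⟩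
  rw [← h a ha b hb, hψx a ha b hb]

/-- A boundary point in the shadow of `A` is approximated by points `x` of `A`, and a geodesic
from the identity to `x` passes near a given point of `A` close to `B_n`. -/
theorem exists_approx_of_mem_shadowSet (hSfin : S.Finite) (hgen : Subgroup.closure S = ⊤)
    {n k N : ℕ} {A : Set G} (hA : A ∈ InfAtoms S n) {ψ : FBar G} (hψ : ψ ∈ shadowSet S n A)
    {a : G} (ha : a ∈ A) (hak : wordDist S 1 a ≤ n + k) (hN : n ≤ N) :
    ∃ x P, GeodBetween S 1 P x ∧ wordDist S 1 P = n ∧ wordDist S a P ≤ k ∧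
      N ≤ wordDist S 1 x ∧ SameAtom S n a x ∧
      ∀ p ∈ ball S N, ∀ q ∈ ball S N,
        horoDiff p q ψ = (wordDist S x p : ℤ) - wordDist S x q := by
  obtain ⟨hψ', z, hz, hψz⟩ := mem_shadowSet_iff.1 hψ
  obtain ⟨x, hxN, hx⟩ := exists_approx_of_mem_horoBoundary hSfin hgen hψ' N
  have hax : SameAtom S n a x := by
    intro p hp q hq
    have h1 := sameAtom_of_mem_infAtoms hA ha hz p hp q hq
    have h2 := hψz p hp q hq
    rw [mem_ball_iff] at hp hq
    have h3 := hx p (mem_ball_iff.2 (hp.trans hN)) q (mem_ball_iff.2 (hq.trans hN))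
    omega
  obtain ⟨P, hP, hPn, haP⟩ := exists_geodBetween_near_of_sameAtom hgen hax (hN.trans hxN) hak
  exact ⟨x, P, hP, hPn, haP, hxN, hax, hx⟩

variable {Δ : ℕ}

theorem SlimBetween.agreeOn_boundaryAct (hSfin : S.Finite) (hgen : Subgroup.closure S = ⊤)
    (hslim : SlimBetween S Δ) {n k m : ℕ} {A : Set G} (hA : A ∈ InfAtoms S n) {ψ χ : FBar G}
    (hψ : ψ ∈ shadowSet S n A) (hχ : χ ∈ shadowSet S n A) {a g : G} (ha : a ∈ A)
    (hak : wordDist S 1 a ≤ n + k) (hg : wordDist S 1 g⁻¹ + 3 * Δ < n)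
    (hm : m + k + 4 * Δ ≤ wordDist S g⁻¹ a) :
    AgreeOn (ball S m) (boundaryAct g ψ) (boundaryAct g χ) := by
  obtain ⟨x, P, hP, hPn, haP, -, hax, hx⟩ := exists_approx_of_mem_shadowSet hSfin hgen hA hψ ha hak
    (N := n + m + wordDist S 1 g⁻¹) (by omega)
  obtain ⟨y, Q, hQ, hQn, haQ, -, hay, hy⟩ := exists_approx_of_mem_shadowSet hSfin hgen hA hχ ha hak
    (N := n + m + wordDist S 1 g⁻¹) (by omega)
  have hsame : SameOn S {p | wordDist S g⁻¹ p ≤ m} x y := by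
    refine SameOn.of_geodBetween hgen (U := ball S n) ?_ (fun p hp => ?_) fun p hp => ?_
    · intro p hp q hq
      have h1 := hax p hp q hq
      have h2 := hay p hp q hq
      omega
    · obtain ⟨q, hq, hq'⟩ := hslim.exists_geodBetween_mem_ball hgen hP hPn haP hg hm hp
      exact ⟨q, mem_ball_iff.2 hq, hq'⟩
    · obtain ⟨q, hq, hq'⟩ := hslim.exists_geodBetween_mem_ball hgen hQ hQn haQ hg hm hp
      exact ⟨q, mem_ball_iff.2 hq, hq'⟩
  have hmem : ∀ p ∈ ball S m, wordDist S g⁻¹ (g⁻¹ * p) ≤ m ∧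
      g⁻¹ * p ∈ ball S (n + m + wordDist S 1 g⁻¹) := by
    intro p hp
    have h1 : wordDist S g⁻¹ (g⁻¹ * p) ≤ m := by
      rw [wordDist_mul_right_eq]
      exact hp
    have h2 := wordDist_triangle hgen 1 g⁻¹ (g⁻¹ * p)
    exact ⟨h1, mem_ball_iff.2 (by omega)⟩
  intro p hp q hq
  obtain ⟨hp1, hp2⟩ := hmem p hp
  obtain ⟨hq1, hq2⟩ := hmem q hq
  rw [horoDiff_boundaryAct, horoDiff_boundaryAct, hx _ hp2 _ hq2, hy _ hp2 _ hq2]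
  have := hsame _ hp1 _ hq1
  omega

theorem SlimBetween.agreeOn_of_boundaryAct (hSfin : S.Finite) (hgen : Subgroup.closure S = ⊤)
    (hslim : SlimBetween S Δ) {n k K m : ℕ} {A : Set G} (hA : A ∈ InfAtoms S n) {ψ χ : FBar G}
    (hψ : ψ ∈ shadowSet S n A) (hχ : χ ∈ shadowSet S n A) {a g : G} (ha : a ∈ A)
    (hak : wordDist S 1 a ≤ n + k) (hm : wordDist S g⁻¹ a + K + 2 * Δ + k ≤ m)
    (hagree : AgreeOn (ball S m) (boundaryAct g ψ) (boundaryAct g χ)) :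
    AgreeOn (ball S (n + K)) ψ χ := by
  set N := n + K + m + wordDist S 1 g⁻¹ with hN
  obtain ⟨x, P, hP, hPn, haP, -, hax, hx⟩ := exists_approx_of_mem_shadowSet hSfin hgen hA hψ ha hak
    (N := N) (by omega)
  obtain ⟨y, Q, hQ, hQn, haQ, -, hay, hy⟩ := exists_approx_of_mem_shadowSet hSfin hgen hA hχ ha hak
    (N := N) (by omega)
  have hsame : SameOn S (ball S (n + K)) x y := by
    refine SameOn.of_geodBetween hgen (U := {p | wordDist S g⁻¹ p ≤ m}) ?_
      (fun p hp => ?_) fun p hp => ?_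
    · intro p hp q hq
      have hmem : ∀ p, wordDist S g⁻¹ p ≤ m → p ∈ ball S N ∧ g * p ∈ ball S m := by
        intro p hp
        have h1 := wordDist_triangle hgen 1 g⁻¹ p
        refine ⟨mem_ball_iff.2 (by omega), ?_⟩
        rw [wordDist, inv_inv] at hp
        exact hp
      obtain ⟨hp1, hp2⟩ := hmem p hp
      obtain ⟨hq1, hq2⟩ := hmem q hq
      have h1 := hagree _ hp2 _ hq2
      rw [horoDiff_boundaryAct, horoDiff_boundaryAct, inv_mul_cancel_left,
        inv_mul_cancel_left] at h1
      have h2 := hx p hp1 q hq1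
      have h3 := hy p hp1 q hq1
      omega
    · exact hslim.exists_geodBetween_mem_translate hgen hP hPn haP hm (mem_ball_iff.1 hp)
    · exact hslim.exists_geodBetween_mem_translate hgen hQ hQn haQ hm (mem_ball_iff.1 hp)
  intro p hp q hq
  have h1 := hsame p hp q hq
  rw [mem_ball_iff] at hp hq
  rw [hx p (mem_ball_iff.2 (by omega)) q (mem_ball_iff.2 (by omega)),
    hy p (mem_ball_iff.2 (by omega)) q (mem_ball_iff.2 (by omega))]
  omega

theorem SlimBetween.wordDist_le_of_mem_shadowSet (hSfin : S.Finite)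
    (hgen : Subgroup.closure S = ⊤) (hslim : SlimBetween S Δ) {n m k C : ℕ} {A B : Set G}
    (hA : A ∈ InfAtoms S n) (hB : B ∈ InfAtoms S m) {ψ : FBar G} (hψ : ψ ∈ shadowSet S n A)
    {a b g : G} (hgψ : boundaryAct g ψ ∈ shadowSet S m B) (ha : a ∈ A) (hb : b ∈ B)
    (hak : wordDist S 1 a ≤ n + k) (hbk : wordDist S 1 b ≤ m + k)
    (hg : wordDist S 1 g⁻¹ + Δ < n) (hm : m ≤ wordDist S g⁻¹ a + C)
    (hm' : wordDist S g⁻¹ a ≤ m + C) : wordDist S (g⁻¹ * b) a ≤ C + 3 * k + 4 * Δ := by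
  obtain ⟨x, P, hP, hPn, haP, hxN, hax, hx⟩ :=
    exists_approx_of_mem_shadowSet hSfin hgen hA hψ ha hak
      (N := n + m + wordDist S 1 g⁻¹) (by omega)
  have hbx : SameAtom S m b (g * x) := by
    obtain ⟨-, z, hz, hzψ⟩ := mem_shadowSet_iff.1 hgψ
    have hmem : ∀ p ∈ ball S m, g⁻¹ * p ∈ ball S (n + m + wordDist S 1 g⁻¹) := by
      intro p hp
      have h1 : wordDist S g⁻¹ (g⁻¹ * p) ≤ m := by
        rw [wordDist_mul_right_eq]
        exact hp
      have h2 := wordDist_triangle hgen 1 g⁻¹ (g⁻¹ * p)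
      exact mem_ball_iff.2 (by omega)
    intro p hp q hq
    have h1 := hzψ p hp q hq
    rw [horoDiff_boundaryAct, hx _ (hmem p hp) _ (hmem q hq)] at h1
    have h2 := sameAtom_of_mem_infAtoms hB hb hz p hp q hq
    rw [wordDist_mul_left_eq, wordDist_mul_left_eq]
    omega
  have hgx : wordDist S 1 (g * x) = wordDist S g⁻¹ x := by
    simp [wordDist]
  have t := wordDist_triangle hgen 1 g⁻¹ x
  obtain ⟨Q, hQ, hQm, hbQ⟩ := exists_geodBetween_near_of_sameAtom hgen hbx (by omega) hbk
  refine hslim.wordDist_le hgen hP hPn haP (Q := g⁻¹ * Q) ?_ ?_ ?_ hg hm hm'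
  · unfold GeodBetween at hQ ⊢
    rw [wordDist_mul_right_eq, wordDist_mul_left_eq, inv_inv, ← wordDist_one_left, hQ, hgx]
  · rw [wordDist_mul_right_eq, ← wordDist_one_left, hQm]
  · rwa [wordDist_mul_left]

end Shadows

namespace FinDigraph

section Paths

variable {Γ : FinDigraph}

theorem FinPath.ext' {α β : Γ.FinPath} (h : α.start = β.start) (h' : α.edges = β.edges) :
    α = β := by
  cases α
  cases β
  subst h h'
  rfl

theorem pathOk_ofFn {x : ℕ → Γ.E} (hx : x ∈ Γ.shift) (n : ℕ) :
    Γ.pathOk (Γ.o (x 0)) (List.ofFn fun i : Fin n => x i) ∧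
      Γ.pathEndAux (Γ.o (x 0)) (List.ofFn fun i : Fin n => x i) = Γ.o (x n) := by
  induction n generalizing x with
  | zero => simp [pathOk, pathEndAux]
  | succ n ih =>
    have h := ih (x := fun i => x (i + 1)) fun i => hx (i + 1)
    rw [List.ofFn_succ]
    simp only [pathOk, pathEndAux, Fin.val_zero, Fin.val_succ, true_and]
    rw [show Γ.t (x 0) = Γ.o (x 1) from hx 0]
    exact h

/-- The prefix of length `n` of an infinite path. -/
def prefixPath (x : ℕ → Γ.E) (hx : x ∈ Γ.shift) (n : ℕ) : Γ.FinPath :=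
  ⟨Γ.o (x 0), List.ofFn fun i : Fin n => x i, (pathOk_ofFn hx n).1⟩

theorem length_prefixPath {x : ℕ → Γ.E} (hx : x ∈ Γ.shift) (n : ℕ) :
    (prefixPath x hx n).edges.length = n :=
  List.length_ofFn

theorem pathEnd_prefixPath {x : ℕ → Γ.E} (hx : x ∈ Γ.shift) (n : ℕ) :
    Γ.pathEnd (prefixPath x hx n) = Γ.o (x n) :=
  (pathOk_ofFn hx n).2

theorem mem_cone_prefixPath_iff {x y : ℕ → Γ.E} (hx : x ∈ Γ.shift) {n : ℕ} :
    y ∈ Γ.cone (prefixPath x hx n) ↔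
      y ∈ Γ.shift ∧ Γ.o (y 0) = Γ.o (x 0) ∧ ∀ i < n, y i = x i := by
  simp only [cone, prefixPath, Set.mem_ofPred_eq, List.length_ofFn, List.get_ofFn]
  exact Iff.rfl

theorem mem_cone_trivPath_iff {x : ℕ → Γ.E} {v : Γ.V} :
    x ∈ Γ.cone (Γ.trivPath v) ↔ x ∈ Γ.shift ∧ Γ.o (x 0) = v := by
  simp [cone, trivPath]

theorem cone_subset_cone_trivPath (α : Γ.FinPath) :
    Γ.cone α ⊆ Γ.cone (Γ.trivPath α.start) :=
  fun _ hx => mem_cone_trivPath_iff.2 ⟨hx.1, hx.2.1⟩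

theorem eq_prefixPath_of_mem_cone {α : Γ.FinPath} {x : ℕ → Γ.E} (hx : x ∈ Γ.cone α) :
    α = prefixPath x hx.1 α.edges.length := by
  refine FinPath.ext' hx.2.1.symm (List.ext_getElem (by simp [prefixPath]) fun i h _ => ?_)
  simpa [prefixPath] using (hx.2.2 i h).symm

theorem pathEnd_eq_of_mem_cone {α : Γ.FinPath} {x : ℕ → Γ.E} (hx : x ∈ Γ.cone α) :
    Γ.pathEnd α = Γ.o (x α.edges.length) := by
  conv_lhs => rw [eq_prefixPath_of_mem_cone hx]
  exact pathEnd_prefixPath hx.1 _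

theorem catPath_of_lt (α : Γ.FinPath) (w : ℕ → Γ.E) {i : ℕ} (h : i < α.edges.length) :
    Γ.catPath α w i = α.edges[i] := by
  simp [catPath, splice, h]

theorem catPath_add (α : Γ.FinPath) (w : ℕ → Γ.E) (i : ℕ) :
    Γ.catPath α w (i + α.edges.length) = w i := by
  simp [catPath, splice, trivPath]

theorem append_mem_shift (l : List Γ.E) {v : Γ.V} (hl : Γ.pathOk v l) {w : ℕ → Γ.E}
    (hw : w ∈ Γ.shift) (h0 : Γ.o (w 0) = Γ.pathEndAux v l) {x : ℕ → Γ.E}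
    (hxl : ∀ i (h : i < l.length), x i = l[i]) (hxw : ∀ i, x (i + l.length) = w i) :
    x ∈ Γ.shift ∧ Γ.o (x 0) = v := by
  induction l generalizing v x with
  | nil =>
    obtain rfl : x = w := funext fun i => hxw i
    exact ⟨hw, h0⟩
  | cons e l ih =>
    obtain ⟨rfl, hl⟩ := hl
    have he : x 0 = e := hxl 0 (by simp)
    obtain ⟨h1, h2⟩ := ih (x := fun i => x (i + 1)) hl h0
      (fun i h => (hxl (i + 1) (by simpa using h)).trans rfl)
      (fun i => by simpa [add_assoc] using hxw i)
    refine ⟨fun i => ?_, by rw [he]⟩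
    cases i with
    | zero => rw [he]; exact h2.symm
    | succ i => exact h1 i

theorem catPath_mem_cone {α : Γ.FinPath} {w : ℕ → Γ.E}
    (hw : w ∈ Γ.cone (Γ.trivPath (Γ.pathEnd α))) : Γ.catPath α w ∈ Γ.cone α := by
  rw [mem_cone_trivPath_iff] at hw
  obtain ⟨h1, h2⟩ := append_mem_shift α.edges α.ok hw.1 hw.2
    (fun i h => catPath_of_lt α w h) (catPath_add α w)
  exact ⟨h1, h2, fun i h => catPath_of_lt α w h⟩

theorem tail_mem_cone {α : Γ.FinPath} {x : ℕ → Γ.E} (hx : x ∈ Γ.cone α) :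
    (fun i => x (i + α.edges.length)) ∈ Γ.cone (Γ.trivPath (Γ.pathEnd α)) := by
  refine mem_cone_trivPath_iff.2 ⟨fun i => ?_, ?_⟩
  · have := hx.1 (i + α.edges.length)
    simp only [this, add_right_comm]
  · simp [pathEnd_eq_of_mem_cone hx]

theorem catPath_tail {α : Γ.FinPath} {x : ℕ → Γ.E} (hx : x ∈ Γ.cone α) :
    Γ.catPath α (fun i => x (i + α.edges.length)) = x := by
  funext i
  by_cases h : i < α.edges.length
  · rw [catPath_of_lt _ _ h]
    exact (hx.2.2 i h).symm
  · obtain ⟨j, rfl⟩ := Nat.exists_eq_add_of_le' (not_lt.1 h)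
    rw [catPath_add]

theorem finite_finPath_length_lt (Γ : FinDigraph) (N : ℕ) :
    {α : Γ.FinPath | α.edges.length < N}.Finite := by
  refine Set.Finite.of_finite_image (f := fun α => (α.start, α.edges)) ?_ ?_
  · refine (Set.finite_univ.prod (List.finite_length_lt Γ.E N)).subset ?_
    rintro _ ⟨α, hα, rfl⟩
    exact ⟨Set.mem_univ _, hα⟩
  · rintro α - β - h
    exact FinPath.ext' (congrArg Prod.fst h) (congrArg Prod.snd h)

theorem isOpen_cone_preimage (α : Γ.FinPath) :
    IsOpen ((Subtype.val : ↥(Γ.cone (Γ.trivPath α.start)) → ℕ → Γ.E) ⁻¹' Γ.cone α) := by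
  have : (Subtype.val : ↥(Γ.cone (Γ.trivPath α.start)) → ℕ → Γ.E) ⁻¹' Γ.cone α =
      ⋂ i : Fin α.edges.length,
        (fun x : ↥(Γ.cone (Γ.trivPath α.start)) => (x : ℕ → Γ.E) i) ⁻¹' {α.edges[i]} := by
    ext ⟨x, hx⟩
    rw [mem_cone_trivPath_iff] at hx
    rw [Set.mem_iInter]
    exact ⟨fun h i => h.2.2 i i.2, fun h => ⟨hx.1, hx.2, fun i hi => h ⟨i, hi⟩⟩⟩
  rw [this]
  refine isOpen_iInter_of_finite fun i => ?_
  exact (isOpen_discrete {α.edges[i]}).preimage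
    ((continuous_apply (i : ℕ)).comp continuous_subtype_val)

end Paths

end FinDigraph

section Addresses

variable {G : Type} [Group G] {S : Set G} {Γ : FinDigraph} {r : Γ.V}

/-- Points of `C_r` share a prefix of length `k` exactly when the corresponding boundary points
agree on `B_k`. -/
theorem forall_lt_eq_iff_agreeOn_ball (φ : ↥(Γ.cone (Γ.trivPath r)) → ↥(horoBoundary S))
    (Aat : (α : Γ.FinPath) → α.start = r → Set G)
    (hAmem : ∀ α hα, Aat α hα ∈ InfAtoms S α.edges.length)
    (hAshadow : ∀ α hα, ∀ x, ∀ hx : x ∈ Γ.cone (Γ.trivPath r),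
      ((φ ⟨x, hx⟩ : ↥(horoBoundary S)) : FBar G) ∈
          shadowSet S α.edges.length (Aat α hα) ↔ x ∈ Γ.cone α)
    {x y : ℕ → Γ.E} (hx : x ∈ Γ.cone (Γ.trivPath r)) (hy : y ∈ Γ.cone (Γ.trivPath r)) (k : ℕ) :
    (∀ i < k, x i = y i) ↔
      AgreeOn (ball S k) (φ ⟨x, hx⟩ : FBar G) (φ ⟨y, hy⟩ : FBar G) := by
  have hx' := FinDigraph.mem_cone_trivPath_iff.1 hx
  have hy' := FinDigraph.mem_cone_trivPath_iff.1 hy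
  set γ := FinDigraph.prefixPath x hx'.1 k with hγ
  have hlen : γ.edges.length = k := FinDigraph.length_prefixPath hx'.1 k
  have hmem : ∀ z, z ∈ Γ.cone γ ↔ z ∈ Γ.shift ∧ Γ.o (z 0) = Γ.o (x 0) ∧ ∀ i < k, z i = x i :=
    fun z => FinDigraph.mem_cone_prefixPath_iff hx'.1
  have hxs := (hAshadow γ hx'.2 x hx).2 ((hmem x).2 ⟨hx'.1, rfl, fun _ _ => rfl⟩)
  constructor
  · intro h
    have hys := (hAshadow γ hx'.2 y hy).2
      ((hmem y).2 ⟨hy'.1, hy'.2.trans hx'.2.symm, fun i hi => (h i hi).symm⟩)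
    have := agreeOn_ball_of_mem_shadowSet (hAmem γ hx'.2) hxs hys
    rwa [hlen] at this
  · intro h i hi
    have hys := AgreeOn.mem_shadowSet (by rwa [hlen]) hxs (φ ⟨y, hy⟩).2
    exact (((hmem y).1 ((hAshadow γ hx'.2 y hy).1 hys)).2.2 i hi).symm

theorem exists_ne_of_cone_nonempty
    (hnoiso : ∀ ψ : ↥(horoBoundary S), ¬IsOpen ({ψ} : Set ↥(horoBoundary S)))
    (φ : ↥(Γ.cone (Γ.trivPath r)) ≃ₜ ↥(horoBoundary S)) {α : Γ.FinPath} (hα : α.start = r)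
    (hne : (Γ.cone α).Nonempty) : ∃ x ∈ Γ.cone α, ∃ y ∈ Γ.cone α, x ≠ y := by
  subst hα
  obtain ⟨x, hx⟩ := hne
  refine ⟨x, hx, ?_⟩
  by_contra! h
  set x' : ↥(Γ.cone (Γ.trivPath α.start)) := ⟨x, FinDigraph.cone_subset_cone_trivPath α hx⟩
  have hopen := FinDigraph.isOpen_cone_preimage α
  have hsingle : (Subtype.val : ↥(Γ.cone (Γ.trivPath α.start)) → ℕ → Γ.E) ⁻¹' Γ.cone α = {x'} := by
    ext y
    constructor
    · intro hy
      exact Subtype.ext (h y hy).symm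
    · rintro rfl
      exact hx
  rw [hsingle] at hopen
  refine hnoiso (φ x') ?_
  have := φ.isOpenMap _ hopen
  rwa [Set.image_singleton] at this

/-- For a sufficiently deep cone `C_α`, the atoms `A_α` and `A_β` with `β = f̄(α)` are matched
up to a bounded error by the group element inducing `f`. -/
theorem exists_barPath_wordDist_le (hSfin : S.Finite) (hgen : Subgroup.closure S = ⊤)
    {Δ : ℕ} (hslim : SlimBetween S Δ) (φ : ↥(Γ.cone (Γ.trivPath r)) → ↥(horoBoundary S))
    (Aat : (α : Γ.FinPath) → α.start = r → Set G)
    (hAmem : ∀ α hα, Aat α hα ∈ InfAtoms S α.edges.length)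
    (hAshadow : ∀ α hα, ∀ x, ∀ hx : x ∈ Γ.cone (Γ.trivPath r),
      ((φ ⟨x, hx⟩ : ↥(horoBoundary S)) : FBar G) ∈
          shadowSet S α.edges.length (Aat α hα) ↔ x ∈ Γ.cone α)
    {g : G} {f : (ℕ → Γ.E) → ℕ → Γ.E}
    (hf : ∀ x ∈ Γ.cone (Γ.trivPath r), f x ∈ Γ.cone (Γ.trivPath r))
    (hfg : ∀ x, ∀ hx : x ∈ Γ.cone (Γ.trivPath r), ∀ hfx : f x ∈ Γ.cone (Γ.trivPath r),
      ((φ ⟨f x, hfx⟩ : ↥(horoBoundary S)) : FBar G) =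
        boundaryAct g ((φ ⟨x, hx⟩ : ↥(horoBoundary S)) : FBar G))
    {k K : ℕ} {α : Γ.FinPath} (hα : α.start = r)
    (hlen : wordDist S 1 g⁻¹ + 3 * Δ < α.edges.length)
    (hsep : ∃ x ∈ Γ.cone α, ∃ y ∈ Γ.cone α, ∃ j < α.edges.length + K, x j ≠ y j)
    {a : G} (ha : a ∈ Aat α hα) (hak : wordDist S 1 a ≤ α.edges.length + k) :
    ∃ (β : Γ.FinPath) (hβ : β.start = r), β.edges.length = Γ.barLen f α ∧
      (∀ x ∈ Γ.cone α, f x ∈ Γ.cone β) ∧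
      ∀ b ∈ Aat β hβ, wordDist S 1 b ≤ β.edges.length + k →
        wordDist S (g⁻¹ * b) a ≤ K + 4 * k + 8 * Δ := by
  have hsub : Γ.cone α ⊆ Γ.cone (Γ.trivPath r) := hα ▸ FinDigraph.cone_subset_cone_trivPath α
  have hshadow : ∀ x (hx : x ∈ Γ.cone α),
      (φ ⟨x, hsub hx⟩ : FBar G) ∈ shadowSet S α.edges.length (Aat α hα) :=
    fun x hx => (hAshadow α hα x (hsub hx)).2 hx
  have hagree := fun {x y} hx hy k =>
    forall_lt_eq_iff_agreeOn_ball φ Aat hAmem hAshadow (x := x) (y := y) hx hy k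
  obtain ⟨x, hx, y, hy, j, hj, hxy⟩ := hsep
  set M : Set ℕ := {n | ∀ x ∈ Γ.cone α, ∀ y ∈ Γ.cone α, ∀ i < n, f x i = f y i} with hM
  have hbar : Γ.barLen f α = sSup M := rfl
  have hlower : ∀ m, m + k + 4 * Δ ≤ wordDist S g⁻¹ a → m ∈ M := by
    intro m hm x hx y hy
    refine (hagree (hf x (hsub hx)) (hf y (hsub hy)) m).2 ?_
    rw [hfg x (hsub hx), hfg y (hsub hy)]
    exact hslim.agreeOn_boundaryAct hSfin hgen (hAmem α hα) (hshadow x hx) (hshadow y hy) ha hak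
      hlen hm
  have hupper : ∀ m ∈ M, m ≤ wordDist S g⁻¹ a + K + 2 * Δ + k := by
    intro m hm
    by_contra! hlt
    have h1 := (hagree (hf x (hsub hx)) (hf y (hsub hy)) m).1 (hm x hx y hy)
    rw [hfg x (hsub hx), hfg y (hsub hy)] at h1
    have h2 := hslim.agreeOn_of_boundaryAct hSfin hgen (hAmem α hα) (hshadow x hx) (hshadow y hy)
      ha hak hlt.le h1
    exact hxy ((hagree (hsub hx) (hsub hy) _).2 h2 j hj)
  have hbdd : BddAbove M := ⟨_, hupper⟩
  have hmem : Γ.barLen f α ∈ M := Nat.sSup_mem ⟨0, fun _ _ _ _ i hi => absurd hi i.not_lt_zero⟩ hbdd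
  have hle := hupper _ hmem
  have hge : wordDist S g⁻¹ a ≤ Γ.barLen f α + (K + 4 * Δ + k) := by
    by_cases hc : k + 4 * Δ ≤ wordDist S g⁻¹ a
    · have := le_csSup hbdd (hlower (wordDist S g⁻¹ a - (k + 4 * Δ)) (by omega))
      rw [← hbar] at this
      omega
    · omega
  have hfx := FinDigraph.mem_cone_trivPath_iff.1 (hf x (hsub hx))
  have hβlen : (FinDigraph.prefixPath (f x) hfx.1 (Γ.barLen f α)).edges.length = Γ.barLen f α :=
    FinDigraph.length_prefixPath hfx.1 _
  have hcone : ∀ z ∈ Γ.cone α, f z ∈ Γ.cone (FinDigraph.prefixPath (f x) hfx.1 (Γ.barLen f α)) := by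
    intro z hz
    have hfz := FinDigraph.mem_cone_trivPath_iff.1 (hf z (hsub hz))
    exact (FinDigraph.mem_cone_prefixPath_iff hfx.1).2
      ⟨hfz.1, hfz.2.trans hfx.2.symm, hmem z hz x hx⟩
  refine ⟨FinDigraph.prefixPath (f x) hfx.1 (Γ.barLen f α), hfx.2, hβlen, hcone,
    fun b hb hbk => ?_⟩
  have hgx := (hAshadow _ hfx.2 _ (hf x (hsub hx))).2 (hcone x hx)
  rw [hfg x (hsub hx)] at hgx
  refine (hslim.wordDist_le_of_mem_shadowSet hSfin hgen (hAmem α hα) (hAmem _ hfx.2)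
    (hshadow x hx) hgx ha hb hak hbk (C := K + 4 * Δ + k) (by omega) ?_ ?_).trans (by omega)
  · rw [hβlen]
    omega
  · rwa [hβlen]

/-- The local actions `C_{t(ρ)} → C_{t(σ)}` induced by `h ∈ G` via the addresses of the cones
`C_ρ` and `C_σ`. -/
def inducedLocalActions (φ : ↥(Γ.cone (Γ.trivPath r)) → ↥(horoBoundary S)) (ρ σ : Γ.FinPath)
    (h : G) : Set (Γ.V × ((ℕ → Γ.E) → ℕ → Γ.E)) :=
  {p | ρ.start = r ∧ σ.start = r ∧ p.1 = Γ.pathEnd ρ ∧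
    (∀ w ∉ Γ.cone (Γ.trivPath (Γ.pathEnd ρ)), p.2 w = w) ∧
    ∀ w ∈ Γ.cone (Γ.trivPath (Γ.pathEnd ρ)),
      p.2 w ∈ Γ.cone (Γ.trivPath (Γ.pathEnd σ)) ∧
      ∀ (h₁ : Γ.catPath ρ w ∈ Γ.cone (Γ.trivPath r))
        (h₂ : Γ.catPath σ (p.2 w) ∈ Γ.cone (Γ.trivPath r)),
        (φ ⟨Γ.catPath σ (p.2 w), h₂⟩ : FBar G) =
          boundaryAct h (φ ⟨Γ.catPath ρ w, h₁⟩ : FBar G)}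

theorem subsingleton_inducedLocalActions {φ : ↥(Γ.cone (Γ.trivPath r)) → ↥(horoBoundary S)}
    (hφ : Function.Injective φ) (ρ σ : Γ.FinPath) (h : G) :
    (inducedLocalActions φ ρ σ h).Subsingleton := by
  rintro ⟨_, p⟩ ⟨hρ, hσ, rfl, hp, hp'⟩ ⟨_, q⟩ ⟨-, -, rfl, hq, hq'⟩
  refine Prod.ext rfl (funext fun w => ?_)
  by_cases hw : w ∈ Γ.cone (Γ.trivPath (Γ.pathEnd ρ))
  · obtain ⟨hpw, hpe⟩ := hp' w hw
    obtain ⟨hqw, hqe⟩ := hq' w hw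
    have hroot : ∀ γ : Γ.FinPath, γ.start = r → ∀ u ∈ Γ.cone (Γ.trivPath (Γ.pathEnd γ)),
        Γ.catPath γ u ∈ Γ.cone (Γ.trivPath r) := by
      rintro γ rfl u hu
      exact FinDigraph.cone_subset_cone_trivPath γ (FinDigraph.catPath_mem_cone hu)
    have h₁ := hpe (hroot ρ hρ w hw) (hroot σ hσ _ hpw)
    have h₂ := hqe (hroot ρ hρ w hw) (hroot σ hσ _ hqw)
    have h₃ := congrArg Subtype.val (hφ (Subtype.ext (h₁.trans h₂.symm)))
    funext i
    show p w i = q w i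
    rw [← FinDigraph.catPath_add σ (p w) i, ← FinDigraph.catPath_add σ (q w) i]
    exact congrFun h₃ _
  · exact (hp w hw).trans (hq w hw).symm

end Addresses

/-- If `G` is a hyperbolic group whose horofunction boundary has no isolated points,
`Γ` is its type graph with root node `r`, and `φ : C_r → ∂_h G` is a system of
addresses, then the nucleus of the induced group `G^φ = {g|_r : g ∈ G} ≤ R_{Γ,C_r}` is
finite. -/
theorem nucleus_of_hyperbolic_group_finite (G : Type) [Group G]
    (S : Set G) (hSfin : S.Finite) (hgen : Subgroup.closure S = ⊤)
    (δ : ℝ) (hδ : 0 < δ) (hhyp : SlimTriangles S δ)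
    (hnoiso : ∀ ψ : ↥(horoBoundary S), ¬IsOpen ({ψ} : Set ↥(horoBoundary S)))
    (Γ : FinDigraph) (r : Γ.V) (τ : AtomIdx S → Γ.V)
    (hτ : IsTypeGraph S Γ τ)
    (hroot : ∀ p : AtomIdx S, p.1 = 0 → τ p = r)
    -- `φ` is a homeomorphism `C_r → ∂_h G`
    (φ : ↥(Γ.cone (Γ.trivPath r)) ≃ₜ ↥(horoBoundary S))
    -- the assignment of atoms to finite paths starting at `r`
    (Aat : (α : Γ.FinPath) → α.start = r → Set G)
    (hAmem : ∀ α hα, Aat α hα ∈ InfAtoms S α.edges.length)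
    -- (i) `φ` maps the cone of `α` onto the shadow of the atom `A_α`…
    (hAshadow : ∀ α hα, ∀ x, ∀ hx : x ∈ Γ.cone (Γ.trivPath r),
      ((φ ⟨x, hx⟩ : ↥(horoBoundary S)) : FBar G) ∈
          shadowSet S α.edges.length (Aat α hα) ↔ x ∈ Γ.cone α)
    -- …where `A_α` has type `t(α)`…
    (hAtype : ∀ α hα, τ ⟨α.edges.length, ⟨Aat α hα, hAmem α hα⟩⟩ = Γ.pathEnd α)
    -- …and the assignment is an isomorphism of trees:
    (hAsurj : ∀ (n : ℕ) (A : Set G), A ∈ InfAtoms S n →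
      ∃ α, ∃ hα : α.start = r, α.edges.length = n ∧ Aat α hα = A)
    (hAinj : ∀ α β hα hβ, α.edges.length = β.edges.length →
      Aat α hα = Aat β hβ → α = β)
    (hAmono : ∀ α β hα hβ, Γ.cone β ⊆ Γ.cone α → Aat β hβ ⊆ Aat α hα)
    -- (ii) whenever `t(α) = t(β)` there is a morphism `g : A_α → A_β` with
    -- `φ(β·ω) = g·φ(α·ω)` for all `ω ∈ C_{t(α)}`:
    (hmorph : ∀ α β (hα : α.start = r) (hβ : β.start = r),
      Γ.pathEnd α = Γ.pathEnd β →
      ∃ g : G, IsMorphism S g α.edges.length (Aat α hα) β.edges.length (Aat β hβ) ∧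
        ∀ ω ∈ Γ.cone (Γ.trivPath (Γ.pathEnd α)),
          ∀ (h1 : Γ.catPath α ω ∈ Γ.cone (Γ.trivPath r))
            (h2 : Γ.catPath β ω ∈ Γ.cone (Γ.trivPath r)),
            ((φ ⟨Γ.catPath β ω, h2⟩ : ↥(horoBoundary S)) : FBar G) =
              boundaryAct g ((φ ⟨Γ.catPath α ω, h1⟩ : ↥(horoBoundary S)) : FBar G)) :
    -- conclusion: the nucleus of `G^φ` is finite, where the elements of `G^φ` are the
    -- self-maps of `C_r` representing (via `φ`) the action of the elements of `G`
    (⋃ (g : G) (f : (ℕ → Γ.E) → ℕ → Γ.E)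
        (_ : (∀ x ∈ Γ.cone (Γ.trivPath r), f x ∈ Γ.cone (Γ.trivPath r)) ∧
          ∀ x, ∀ hx : x ∈ Γ.cone (Γ.trivPath r), ∀ hfx : f x ∈ Γ.cone (Γ.trivPath r),
            ((φ ⟨f x, hfx⟩ : ↥(horoBoundary S)) : FBar G) =
              boundaryAct g ((φ ⟨x, hx⟩ : ↥(horoBoundary S)) : FBar G)),
      Γ.nucleusOf f (Γ.cone (Γ.trivPath r))).Finite := by
  set Δ := ⌊δ⌋₊
  have hslim : SlimBetween S Δ := hhyp.slimBetween hgen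
  obtain ⟨rep, hrep⟩ : ∃ rep : Γ.V → Γ.FinPath, ∀ α : Γ.FinPath, α.start = r →
      (rep (Γ.pathEnd α)).start = r ∧ Γ.pathEnd (rep (Γ.pathEnd α)) = Γ.pathEnd α := by
    have : ∀ v, ∃ ρ : Γ.FinPath, ∀ α : Γ.FinPath, α.start = r → Γ.pathEnd α = v →
        ρ.start = r ∧ Γ.pathEnd ρ = v := by
      intro v
      by_cases h : ∃ α : Γ.FinPath, α.start = r ∧ Γ.pathEnd α = v
      · exact h.imp fun ρ hρ _ _ _ => hρ
      · exact ⟨Γ.trivPath v, fun α hα hv => absurd ⟨α, hα, hv⟩ h⟩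
    choose rep hrep using this
    exact ⟨rep, fun α hα => hrep _ α hα rfl⟩
  obtain ⟨k, hk⟩ : ∃ k, ∀ v (hv : (rep v).start = r),
      ∃ p ∈ Aat (rep v) hv, wordDist S 1 p ≤ k := by
    have : ∀ v, ∃ k, ∀ hv : (rep v).start = r, ∃ p ∈ Aat (rep v) hv, wordDist S 1 p ≤ k := by
      intro v
      by_cases hv : (rep v).start = r
      · obtain ⟨p, hp⟩ := (hAmem _ hv).2.nonempty
        exact ⟨wordDist S 1 p, fun _ => ⟨p, hp, le_rfl⟩⟩
      · exact ⟨0, fun h => absurd h hv⟩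
    choose k hk using this
    refine ⟨Finset.univ.sup k, fun v hv => ?_⟩
    obtain ⟨p, hp, hpk⟩ := hk v hv
    exact ⟨p, hp, hpk.trans (Finset.le_sup (Finset.mem_univ v))⟩
  obtain ⟨K, hK⟩ : ∃ K, ∀ α : Γ.FinPath, α.start = r → (Γ.cone α).Nonempty →
      ∃ x ∈ Γ.cone α, ∃ y ∈ Γ.cone α, ∃ j < α.edges.length + K, x j ≠ y j := by
    have : ∀ v, ∃ K, ∀ α : Γ.FinPath, α.start = r → Γ.pathEnd α = v → (Γ.cone α).Nonempty →
        ∃ x ∈ Γ.cone α, ∃ y ∈ Γ.cone α, ∃ j < α.edges.length + K, x j ≠ y j := by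
      intro v
      by_cases h : ∃ α : Γ.FinPath, α.start = r ∧ Γ.pathEnd α = v ∧ (Γ.cone α).Nonempty
      · obtain ⟨ρ, hρ, rfl, hne⟩ := h
        obtain ⟨x, hx, y, hy, hxy⟩ := exists_ne_of_cone_nonempty hnoiso φ hρ hne
        have hlt : ∃ j, x (j + ρ.edges.length) ≠ y (j + ρ.edges.length) := by
          by_contra! h
          refine hxy ?_
          rw [← FinDigraph.catPath_tail hx, ← FinDigraph.catPath_tail hy, funext h]
        obtain ⟨j, hj⟩ := hlt
        refine ⟨j + 1, fun α _ hv _ => ⟨_, FinDigraph.catPath_mem_cone (hv ▸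
          FinDigraph.tail_mem_cone hx), _, FinDigraph.catPath_mem_cone (hv ▸
          FinDigraph.tail_mem_cone hy), j + α.edges.length, by omega, ?_⟩⟩
        rwa [FinDigraph.catPath_add, FinDigraph.catPath_add]
      · exact ⟨0, fun α hα hv hne => absurd ⟨α, hα, hv, hne⟩ h⟩
    choose K hK using this
    refine ⟨Finset.univ.sup K, fun α hα hne => ?_⟩
    obtain ⟨x, hx, y, hy, j, hj, hxy⟩ := hK _ α hα rfl hne
    have : K (Γ.pathEnd α) ≤ Finset.univ.sup K := Finset.le_sup (Finset.mem_univ _)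
    exact ⟨x, hx, y, hy, j, by omega, hxy⟩
  have hpoint : ∀ α (hα : α.start = r) (h : G),
      IsMorphism S h (rep (Γ.pathEnd α)).edges.length (Aat _ (hrep α hα).1)
        α.edges.length (Aat α hα) →
      ∃ a ∈ Aat α hα, wordDist S 1 a ≤ α.edges.length + k ∧ wordDist S h a ≤ k := by
    intro α hα h hh
    obtain ⟨p, hp, hpk⟩ := hk _ (hrep α hα).1
    have hmem : h * p ∈ Aat α hα ∩ ball S (α.edges.length + k) := by
      rw [← hh.2.1 k]
      exact ⟨p, ⟨hp, mem_ball_iff.2 (by omega)⟩, rfl⟩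
    refine ⟨h * p, hmem.1, mem_ball_iff.1 hmem.2, ?_⟩
    rwa [wordDist_mul_right_eq, ← wordDist_one_left]
  refine Set.Finite.subset ((Set.finite_range fun v : Γ.V => (v, (id : (ℕ → Γ.E) → _))).union
    (Set.finite_iUnion fun v : Γ.V => Set.finite_iUnion fun w : Γ.V =>
      (finite_ball hSfin hgen (K + 6 * k + 8 * Δ)).biUnion fun h _ =>
        (subsingleton_inducedLocalActions φ.injective (rep v) (rep w) h).finite)) ?_
  intro p hp
  simp only [Set.mem_iUnion] at hp
  obtain ⟨g, f, ⟨hf, hfg⟩, hp⟩ := hp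
  obtain ⟨α, ⟨hsub, rfl⟩, hlen⟩ := (Set.Infinite.sdiff hp
    (FinDigraph.finite_finPath_length_lt Γ (wordDist S 1 g⁻¹ + 3 * Δ + 1))).nonempty
  replace hlen : wordDist S 1 g⁻¹ + 3 * Δ < α.edges.length := by
    simpa [Nat.lt_succ_iff, Nat.add_one_le_iff] using hlen
  rcases (Γ.cone α).eq_empty_or_nonempty with hempty | hne
  · refine Or.inl ⟨Γ.pathEnd α, Prod.ext rfl (funext fun w => ?_)⟩
    refine (if_neg fun hw => ?_).symm
    exact Set.notMem_empty _ (hempty ▸ FinDigraph.catPath_mem_cone hw)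
  right
  have hα : α.start = r := by
    obtain ⟨x, hx⟩ := hne
    exact hx.2.1.symm.trans (FinDigraph.mem_cone_trivPath_iff.1 (hsub hx)).2
  have hroot : ∀ γ : Γ.FinPath, γ.start = r → Γ.cone γ ⊆ Γ.cone (Γ.trivPath r) := by
    rintro γ rfl
    exact FinDigraph.cone_subset_cone_trivPath γ
  obtain ⟨hα₁, hα₂⟩ := hrep α hα
  obtain ⟨u, hu, hu'⟩ := hmorph _ α hα₁ hα hα₂
  obtain ⟨a, ha, hak, hua⟩ := hpoint α hα u hu
  obtain ⟨β, hβ, hβlen, hβcone, hdist⟩ := exists_barPath_wordDist_le hSfin hgen hslim φ Aat hAmem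
    hAshadow hf hfg hα hlen (hK α hα hne) ha hak
  obtain ⟨hβ₁, hβ₂⟩ := hrep β hβ
  obtain ⟨v, hv, hv'⟩ := hmorph _ β hβ₁ hβ hβ₂
  obtain ⟨b, hb, hbk, hvb⟩ := hpoint β hβ v hv
  simp only [Set.mem_iUnion]
  refine ⟨Γ.pathEnd α, Γ.pathEnd β, v⁻¹ * g * u, ?_, hα₁, hβ₁, hα₂.symm, ?_, ?_⟩
  · have h1 := hdist b hb hbk
    have h2 := wordDist_triangle hgen (g⁻¹ * v) (g⁻¹ * b) u
    have h3 := wordDist_triangle hgen (g⁻¹ * b) a u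
    rw [wordDist_mul_left] at h2
    rw [wordDist_comm hgen a u] at h3
    have h4 : wordDist S 1 (v⁻¹ * g * u) = wordDist S (g⁻¹ * v) u := by
      simp [wordDist]
    rw [mem_ball_iff]
    omega
  · intro w hw
    rw [hα₂] at hw
    exact if_neg hw
  · intro w hw
    have hw' := hw
    rw [hα₂] at hw
    have hwα := FinDigraph.catPath_mem_cone hw
    have hy := hβcone _ hwα
    have hval : (Γ.localAction f α).2 w =
        fun i => f (Γ.catPath α w) (i + β.edges.length) := by
      rw [hβlen]
      exact if_pos hw
    rw [hval]
    have htail := FinDigraph.tail_mem_cone hy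
    have hcat := FinDigraph.catPath_tail hy
    refine ⟨by rwa [hβ₂], fun h₁ h₂ => ?_⟩
    have e₁ := hu' w hw' h₁ (hroot α hα hwα)
    have e₂ := hv' _ (by rwa [hβ₂]) h₂ (hcat.symm ▸ hroot β hβ hy)
    have e₃ := hfg _ (hroot α hα hwα) (hroot β hβ hy)
    simp only [hcat] at e₂
    rw [e₃, e₁] at e₂
    rw [mul_assoc, boundaryAct_mul, boundaryAct_mul, e₂, boundaryAct_inv_apply]

end
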